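/- arXiv:1303.0523 — 2 statements merged into one kernel-verified Lean document; each statement's English description precedes it below -/
import Mathlib

section
/- For every finite tree T and every integer t ≥ 1 with 2t ≤ |V(T)|, one has VR(T, t) ≥ 1/4. -/
open SimpleGraph

variable {V : Type*}

/-- Distance from a vertex to a finite set of vertices (`⊤` if the set is empty). -/
noncomputable def distToSet (G : SimpleGraph V) (S : Finset V) (v : V) : ℕ∞ :=
  S.inf fun a => (G.dist a v : ℕ∞)

/-- Player A's Voronoi score. -/
noncomputable def scoreA [Fintype V] (G : SimpleGraph V) (A B : Finset V) : ℝ :=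
  ∑ v : V,
    if distToSet G A v < distToSet G B v then 1
    else if distToSet G A v = distToSet G B v then 1/2 else 0

/-- Player B's Voronoi score. -/
noncomputable def scoreB [Fintype V] (G : SimpleGraph V) (A B : Finset V) : ℝ :=
  ∑ v : V,
    if distToSet G B v < distToSet G A v then 1
    else if distToSet G B v = distToSet G A v then 1/2 else 0

/-- Minimax value (A's score under optimal play) of the Voronoi game with `t`
remaining rounds, given the sets of vertices already claimed by A and B. -/
noncomputable def gameValue [Fintype V] [DecidableEq V] (G : SimpleGraph V) :
    ℕ → Finset V → Finset V → ℝ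
  | 0, A, B => scoreA G A B
  | (t+1), A, B =>
      sSup {r : ℝ | ∃ a, a ∉ A ∧ a ∉ B ∧
        r = sInf {s : ℝ | ∃ b, b ∉ insert a A ∧ b ∉ B ∧
          s = gameValue G t (insert a A) (insert b B)}}

/-- The Voronoi ratio of `G` for a `t`-round game. -/
noncomputable def VR [Fintype V] [DecidableEq V] (G : SimpleGraph V) (t : ℕ) : ℝ :=
  gameValue G t ∅ ∅ / (Fintype.card V)

/-- In a tree, a vertex has at most one neighbour that is not farther from `x`. -/
theorem closer_unique {T : SimpleGraph V} (hconn : T.Connected) (hacyc : T.IsAcyclic)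
    {x a b c : V} (hb : T.Adj b a) (hc : T.Adj c a)
    (h1 : T.dist x b ≤ T.dist x a) (h2 : T.dist x c ≤ T.dist x a) : b = c := by
  classical
  have key : ∀ b, T.Adj b a → T.dist x b ≤ T.dist x a →
      ∃ p : T.Walk x b, p.IsPath ∧ a ∉ p.support := by
    intro b hb h
    obtain ⟨p, hp, hl⟩ := hconn.exists_path_of_dist x b
    refine ⟨p, hp, fun ha => ?_⟩
    have h3 := dist_le (p.takeUntil a ha)
    have h4 : (p.takeUntil a ha).length < p.length := p.length_takeUntil_lt ha hb.ne'
    omega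
  obtain ⟨p, hp, hpa⟩ := key b hb h1
  obtain ⟨q, hq, hqa⟩ := key c hc h2
  have := Subtype.mk.inj (hacyc.subsingleton_path x a |>.elim
    ⟨_, hp.concat hpa hb⟩ ⟨_, hq.concat hqa hc⟩)
  have h5 := congrArg Walk.penultimate this
  simpa using h5

/-- Along a path in a tree, once the distance from `x` increases it keeps increasing. -/
theorem dist_lt_along {T : SimpleGraph V} (hconn : T.Connected) (hacyc : T.IsAcyclic)
    (x : V) {w u : V} (p : T.Walk w u) :
    ∀ {v : V} (h : T.Adj v w), (Walk.cons h p).IsPath → T.dist x v < T.dist x w →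
      T.dist x v < T.dist x u := by
  induction p with
  | nil => intro v h _ hlt; exact hlt
  | @cons w w' u h' p' ih =>
    intro v h hp hlt
    have hp' := (Walk.cons_isPath_iff _ _).1 hp
    have hne : v ≠ w' := by
      rintro rfl
      exact hp'.2 (by simp)
    have hlt' : T.dist x w < T.dist x w' := by
      by_contra hcon
      exact hne (closer_unique hconn hacyc (x := x) h h'.symm hlt.le (not_lt.1 hcon))
    exact hlt.trans (ih h' hp'.1 hlt')

/-- Every finite tree has a centroid. -/
theorem exists_centroid [Fintype V] {T : SimpleGraph V} (hconn : T.Connected)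
    (hacyc : T.IsAcyclic) :
    ∃ v : V, ∀ u : V, 2 * (Finset.univ.filter fun x => T.dist x u < T.dist x v).card
      ≤ Fintype.card V := by
  classical
  have := hconn.nonempty
  obtain ⟨v, -, hv⟩ := Finset.exists_min_image Finset.univ
    (fun v => ∑ x : V, (T.dist x v : ℤ)) Finset.univ_nonempty
  refine ⟨v, fun u => ?_⟩
  obtain ⟨p, hp, -⟩ := hconn.exists_path_of_dist v u
  cases p with
  | nil => simp
  | @cons _ w _ h p =>
    have hsub : (Finset.univ.filter fun x => T.dist x u < T.dist x v) ⊆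
        (Finset.univ.filter fun x => T.dist x w < T.dist x v) := by
      intro x hx
      simp only [Finset.mem_filter, Finset.mem_univ, true_and] at hx ⊢
      by_contra hcon
      have hne := hacyc.dist_ne_of_adj h (hconn x v)
      have := dist_lt_along hconn hacyc x p h hp (by omega)
      omega
    have hcard := Finset.card_le_card hsub
    have h1 := hv w (Finset.mem_univ _)
    have h2 : ∑ x : V, (T.dist x w : ℤ) ≤
        ∑ x : V, ((T.dist x v : ℤ) + (1 - 2 * (if T.dist x w < T.dist x v then 1 else 0))) := by
      apply Finset.sum_le_sum
      intro x _
      have := h.diff_dist_adj (u := x)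
      split_ifs <;> omega
    rw [Finset.sum_add_distrib, Finset.sum_sub_distrib, ← Finset.mul_sum,
      Finset.sum_boole] at h2
    simp only [Finset.sum_const, Finset.card_univ, nsmul_eq_mul, mul_one] at h2
    omega

theorem scoreA_swap [Fintype V] (G : SimpleGraph V) (A B : Finset V) :
    scoreA G A B + scoreA G B A = Fintype.card V := by
  unfold scoreA
  rw [← Finset.sum_add_distrib]
  rw [Finset.sum_congr rfl (g := fun _ => (1 : ℝ))]
  · simp
  · intro x _
    rcases lt_trichotomy (distToSet G A x) (distToSet G B x) with h | h | h
    · simp [h, h.not_gt, h.ne']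
    · simp [h]; norm_num
    · simp [h, h.not_gt, h.ne']

theorem distToSet_anti (G : SimpleGraph V) {A A' : Finset V} (h : A ⊆ A') (x : V) :
    distToSet G A' x ≤ distToSet G A x := Finset.inf_mono h

theorem scoreA_mono [Fintype V] (G : SimpleGraph V) {A A' : Finset V} (B : Finset V)
    (h : A ⊆ A') : scoreA G A B ≤ scoreA G A' B := by
  unfold scoreA
  apply Finset.sum_le_sum
  intro x _
  have h1 := distToSet_anti G h x
  split_ifs with a b c d e f g <;> first | norm_num | skip
  · exact absurd (h1.trans_lt a) b
  · exact absurd (h1.trans_lt a) b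
  · exact absurd (lt_of_le_of_ne (h1.trans d.le) f) e

theorem scoreA_insert [Fintype V] [DecidableEq V] (G : SimpleGraph V) (A B : Finset V)
    (v r : V) (hv : v ∈ A)
    (hc : 2 * (Finset.univ.filter fun x => G.dist x r < G.dist x v).card ≤ Fintype.card V) :
    scoreA G (insert r A) B ≤ scoreA G A B + Fintype.card V / 2 := by
  have h1 : scoreA G (insert r A) B ≤ scoreA G A B +
      (Finset.univ.filter fun x => G.dist x r < G.dist x v).card := by
    unfold scoreA
    rw [← Finset.sum_boole, ← Finset.sum_add_distrib]
    apply Finset.sum_le_sum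
    intro x _
    by_cases hx : G.dist x r < G.dist x v
    · rw [if_pos hx]
      split_ifs <;> norm_num
    · have : distToSet G (insert r A) x = distToSet G A x := by
        unfold distToSet
        rw [Finset.inf_insert, inf_eq_right]
        refine (Finset.inf_le hv).trans ?_
        have : G.dist v x ≤ G.dist r x := by
          rw [dist_comm, dist_comm (u := r)]; omega
        exact_mod_cast this
      rw [this, if_neg hx]; simp
  have h2 : (2 : ℝ) * (Finset.univ.filter fun x => G.dist x r < G.dist x v).card
      ≤ Fintype.card V := by exact_mod_cast hc
  linarith

/-- Value of the position where B is to move and `k` full rounds follow. -/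
noncomputable def moveB [Fintype V] [DecidableEq V] (G : SimpleGraph V) (k : ℕ)
    (A B : Finset V) : ℝ :=
  sInf {s : ℝ | ∃ b, b ∉ A ∧ b ∉ B ∧ s = gameValue G k A (insert b B)}

theorem gameValue_ge [Fintype V] [DecidableEq V] (G : SimpleGraph V) (k : ℕ)
    (A B : Finset V) (a : V) (ha : a ∉ A) (hb : a ∉ B) :
    moveB G k (insert a A) B ≤ gameValue G (k+1) A B := by
  rw [gameValue]
  refine le_csSup ?_ ⟨a, ha, hb, rfl⟩
  refine ((Set.finite_range fun a => moveB G k (insert a A) B).subset ?_).bddAbove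
  rintro r ⟨a, -, -, rfl⟩
  exact ⟨a, rfl⟩

theorem exists_free [Fintype V] [DecidableEq V] (A B : Finset V)
    (h : A.card + B.card < Fintype.card V) : ∃ b, b ∉ A ∧ b ∉ B := by
  have h1 : (A ∪ B).card < (Finset.univ : Finset V).card :=
    (Finset.card_union_le A B).trans_lt h
  obtain ⟨b, -, hb⟩ := Finset.exists_mem_notMem_of_card_lt_card h1
  exact ⟨b, by simpa using hb⟩

theorem moveB_attained [Fintype V] [DecidableEq V] (G : SimpleGraph V) (k : ℕ)
    (A B : Finset V) (h : A.card + B.card < Fintype.card V) :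
    ∃ b, b ∉ A ∧ b ∉ B ∧ moveB G k A B = gameValue G k A (insert b B) := by
  obtain ⟨b, hb⟩ := exists_free A B h
  refine Set.Nonempty.csInf_mem
    (s := {s : ℝ | ∃ b, b ∉ A ∧ b ∉ B ∧ s = gameValue G k A (insert b B)})
    ⟨_, b, hb.1, hb.2, rfl⟩ ?_
  refine (Set.finite_range fun b => gameValue G k A (insert b B)).subset ?_
  rintro r ⟨a, -, -, rfl⟩
  exact ⟨a, rfl⟩

/-- Strategy stealing. -/
theorem steal [Fintype V] [DecidableEq V] (G : SimpleGraph V) (v : V)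
    (hc : ∀ u, 2 * (Finset.univ.filter fun x => G.dist x u < G.dist x v).card
      ≤ Fintype.card V) (k : ℕ) :
    ∀ (A' B : Finset V) (e : V), e ∉ A' → e ∉ B → v ∈ insert e A' →
      A'.card + B.card + 2 * k + 2 ≤ Fintype.card V →
      (Fintype.card V : ℝ) / 2 ≤ moveB G k (insert e A') B + gameValue G (k+1) B A' := by
  induction k with
  | zero =>
    intro A' B e heA heB hv hcard
    have hA : (insert e A').card = A'.card + 1 := Finset.card_insert_of_notMem heA
    obtain ⟨b, hbA, hbB, hb⟩ := moveB_attained G 0 (insert e A') B (by omega)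
    have hbA' : b ∉ A' := fun h => hbA (Finset.mem_insert_of_mem h)
    have hBc : (insert b B).card = B.card + 1 := Finset.card_insert_of_notMem hbB
    obtain ⟨r, hrB, hrA, hr⟩ := moveB_attained G 0 (insert b B) A' (by omega)
    have h1 := gameValue_ge G 0 B A' b hbB hbA'
    rw [hr] at h1
    rw [hb]
    rw [gameValue] at h1 ⊢
    have h2 := scoreA_swap G (insert b B) (insert r A')
    have h3 := scoreA_mono G (insert b B)
      (Finset.insert_subset_insert r (Finset.subset_insert e A'))
    have h4 := scoreA_insert G (insert e A') (insert b B) v r hv (hc r)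
    linarith
  | succ k ih =>
    intro A' B e heA heB hv hcard
    have hA : (insert e A').card = A'.card + 1 := Finset.card_insert_of_notMem heA
    obtain ⟨b, hbA, hbB, hb⟩ := moveB_attained G (k+1) (insert e A') B (by omega)
    have hbA' : b ∉ A' := fun h => hbA (Finset.mem_insert_of_mem h)
    have hbe : b ≠ e := fun h => hbA (h ▸ Finset.mem_insert_self _ _)
    have hBc : (insert b B).card = B.card + 1 := Finset.card_insert_of_notMem hbB
    obtain ⟨r, hrB, hrA, hr⟩ := moveB_attained G (k+1) (insert b B) A' (by omega)
    have h1 := gameValue_ge G (k+1) B A' b hbB hbA'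
    rw [hr] at h1
    rw [hb]
    by_cases hre : r = e
    · subst hre
      obtain ⟨a, haA, haB⟩ := exists_free (insert r A') (insert b B) (by omega)
      have h2 := gameValue_ge G k (insert r A') (insert b B) a haA haB
      have h3 := ih (insert r A') (insert b B) a haA haB
        (Finset.mem_insert_of_mem hv) (by omega)
      linarith
    · have hrA2 : r ∉ insert e A' := by simp [hre, hrA]
      have h2 := gameValue_ge G k (insert e A') (insert b B) r hrA2 hrB
      have hAr : (insert r A').card = A'.card + 1 := Finset.card_insert_of_notMem hrA
      have h3 := ih (insert r A') (insert b B) e (by simp [heA, Ne.symm hre])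
        (by simp [heB, hbe.symm])
        (by
          rw [Finset.insert_comm]
          exact Finset.mem_insert_of_mem hv) (by omega)
      rw [Finset.insert_comm] at h3
      linarith

/-- For every finite tree `T` and every integer `t ≥ 1` with `2t ≤ |V(T)|`,
one has `VR(T, t) ≥ 1/4`. -/
theorem vr_tree_quarter {V : Type*} [Fintype V] [DecidableEq V]
    (T : SimpleGraph V) (hconn : T.Connected) (hacyc : T.IsAcyclic)
    (t : ℕ) (ht : 1 ≤ t) (h2t : 2 * t ≤ Fintype.card V) :
    (1 / 4 : ℝ) ≤ VR T t := by
  obtain ⟨v, hv⟩ := exists_centroid hconn hacyc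
  obtain ⟨k, rfl⟩ : ∃ k, t = k + 1 := ⟨t - 1, by omega⟩
  have h1 := steal T v hv k ∅ ∅ v (by simp) (by simp) (by simp) (by simp; omega)
  have h2 := gameValue_ge T k ∅ ∅ v (by simp) (by simp)
  have hpos : (0 : ℝ) < Fintype.card V := by
    have : 0 < Fintype.card V := by omega
    exact_mod_cast this
  unfold VR
  rw [le_div_iff₀ hpos]
  linarith
end

section
/- Let G be a finite connected graph with n vertices and maximum degree Δ ≥ 1, and let t ≥ 1 be an integer with 2t ≤ n. Then VR(G, t) ≤ 1 − 1/(2Δ) + 1/(2nΔ). -/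
open SimpleGraph

variable {V : Type*}

/-- The player owning `B` (moving second) can force `P` at the end of `k` rounds, on the board
without the vertices of `X`. -/
def SecondWins [DecidableEq V] (X : Finset V) (P : Finset V → Finset V → Prop) :
    ℕ → Finset V → Finset V → Prop
  | 0, A, B => P A B
  | k+1, A, B => ∀ a, a ∉ A → a ∉ B → a ∉ X → ∃ b, b ∉ insert a A ∧ b ∉ B ∧ b ∉ X ∧
      SecondWins X P k (insert a A) (insert b B)

theorem gameValue_le_of_wins [Fintype V] [DecidableEq V] (G : SimpleGraph V) (c : ℝ) (hc : 0 ≤ c) :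
    ∀ (k : ℕ) (A B : Finset V),
      SecondWins ∅ (fun A B => scoreA G A B ≤ c) k A B → gameValue G k A B ≤ c := by
  intro k
  induction k with
  | zero => intro A B h; simpa [gameValue, SecondWins] using h
  | succ k ih =>
    intro A B h
    rw [gameValue]
    apply Real.sSup_le _ hc
    rintro r ⟨a, haA, haB, rfl⟩
    obtain ⟨b, hb1, hb2, -, hb⟩ := h a haA haB (by simp)
    refine le_trans (csInf_le ?_ ⟨b, hb1, hb2, rfl⟩) (ih _ _ hb)
    apply Set.Finite.bddBelow
    apply (Set.finite_range (fun b => gameValue G k (insert a A) (insert b B))).subset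
    rintro s ⟨b, -, -, rfl⟩
    exact ⟨b, rfl⟩

/-- Points for the second set. -/
noncomputable def ptB (G : SimpleGraph V) (A B : Finset V) (v : V) : ℝ :=
  if distToSet G B v < distToSet G A v then 1
    else if distToSet G B v = distToSet G A v then 1/2 else 0

theorem ptB_nonneg (G : SimpleGraph V) (A B : Finset V) (v : V) : 0 ≤ ptB G A B v := by
  unfold ptB; split_ifs <;> norm_num

theorem ptB_swap (G : SimpleGraph V) (A B : Finset V) (v : V) :
    ptB G A B v + ptB G B A v = 1 := by
  unfold ptB
  rcases lt_trichotomy (distToSet G A v) (distToSet G B v) with h | h | h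
  · simp [h, h.not_gt, h.ne, h.ne']
  · simp [h]; norm_num
  · simp [h, h.not_gt, h.ne, h.ne']

theorem scoreA_eq [Fintype V] (G : SimpleGraph V) (A B : Finset V) :
    scoreA G A B = ∑ v, ptB G B A v := rfl

theorem distToSet_insert [DecidableEq V] (G : SimpleGraph V) (A : Finset V) (a v : V) :
    distToSet G (insert a A) v = min (G.dist a v : ℕ∞) (distToSet G A v) := by
  simp [distToSet, Finset.inf_insert]

theorem distToSet_le (G : SimpleGraph V) (A : Finset V) (a v : V) (h : a ∈ A) :
    distToSet G A v ≤ (G.dist a v : ℕ∞) := Finset.inf_le h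

theorem ptB_mono [DecidableEq V] (G : SimpleGraph V) (A B : Finset V) (e v : V) :
    ptB G A B v ≤ ptB G A (insert e B) v := by
  have h : distToSet G (insert e B) v ≤ distToSet G B v := by
    rw [distToSet_insert]; exact min_le_right _ _
  unfold ptB
  split_ifs with h1 h2 h3 h4 h5 h6 <;> try norm_num
  · exact absurd (h.trans_lt h1) h2
  · exact absurd (h.trans_lt h1) h2
  · exact absurd (lt_of_le_of_ne (h.trans h4.le) h6) h5

theorem ptB_ignore [DecidableEq V] (G : SimpleGraph V) (A B : Finset V) (a b v : V)
    (hv : G.dist b v < G.dist a v) (hb : b ∈ A ∨ b ∈ B) :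
    ptB G A B v ≤ ptB G (insert a A) B v := by
  by_cases hle : distToSet G B v ≤ distToSet G A v
  · have h1 : distToSet G B v ≤ (G.dist b v : ℕ∞) := by
      rcases hb with hb | hb
      · exact hle.trans (distToSet_le G A b v hb)
      · exact distToSet_le G B b v hb
    have h2 : distToSet G B v < (G.dist a v : ℕ∞) := lt_of_le_of_lt h1 (by exact_mod_cast hv)
    rcases hle.lt_or_eq with h | h
    · have : distToSet G B v < distToSet G (insert a A) v := by
        rw [distToSet_insert]; exact lt_min h2 h
      simp [ptB, h, this]
    · have : distToSet G (insert a A) v = distToSet G B v := by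
        rw [distToSet_insert, ← h]; exact min_eq_right h2.le
      simp [ptB, h, this]
  · have : ptB G A B v = 0 := by
      push Not at hle
      simp [ptB, hle.not_gt, hle.ne']
    rw [this]; exact ptB_nonneg _ _ _ _

/-- End of the game: enough points on `S` in the reduced game give a good real score. -/
theorem scoreA_le_of [Fintype V] [DecidableEq V] (G : SimpleGraph V) (a b : V) (S A B : Finset V)
    (hS : ∀ v ∈ S, G.dist b v < G.dist a v) (hb : b ∈ A ∨ b ∈ B)
    (h : (S.card : ℝ) ≤ 2 * ∑ v ∈ S, ptB G A B v) :
    scoreA G (insert a A) B ≤ Fintype.card V - (S.card : ℝ) / 2 := by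
  have h1 : scoreA G (insert a A) B + ∑ v, ptB G (insert a A) B v = Fintype.card V := by
    rw [scoreA_eq, ← Finset.sum_add_distrib]
    simp [ptB_swap]
  have h2 : ∑ v ∈ S, ptB G A B v ≤ ∑ v ∈ S, ptB G (insert a A) B v :=
    Finset.sum_le_sum fun v hv => ptB_ignore G A B a b v (hS v hv) hb
  have h3 : ∑ v ∈ S, ptB G (insert a A) B v ≤ ∑ v, ptB G (insert a A) B v :=
    Finset.sum_le_sum_of_subset_of_nonneg (Finset.subset_univ _)
      fun v _ _ => ptB_nonneg _ _ _ _
  linarith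

/-- The second player follows a second-player strategy with an extra stone `e`. -/
theorem wins_extra [Fintype V] [DecidableEq V] (a b : V) (P Q : Finset V → Finset V → Prop)
    (hPQ : ∀ A B e, (b ∈ A ∨ b ∈ insert e B) → P A B → Q (insert a A) (insert e B)) :
    ∀ (k : ℕ) (A B : Finset V) (e : V), e ∉ A → e ∉ B → e ≠ a → (b ∈ A ∨ b ∈ insert e B) →
      A.card + B.card + 2 * k + 2 ≤ Fintype.card V →
      SecondWins {a} P k A B → SecondWins ∅ Q k (insert a A) (insert e B) := by
  intro k
  induction k with
  | zero => intro A B e _ _ _ hb _ h; exact hPQ A B e hb h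
  | succ k ih =>
    intro A B e heA heB hea hb hcard h x hxA hxB _
    simp only [Finset.mem_insert, not_or] at hxA hxB
    obtain ⟨y, hy1, hy2, hy3, hy⟩ := h x hxA.2 hxB.2 (by simpa using hxA.1)
    simp only [Finset.mem_insert, not_or, Finset.mem_singleton] at hy1 hy3
    have hcA := Finset.card_insert_le x A
    have hcB := Finset.card_insert_le y B
    by_cases hye : y = e
    · subst hye
      have : ∃ new, new ∉ insert a (insert x A ∪ insert y B) := by
        by_contra hall
        push Not at hall
        have h1 := Finset.eq_univ_iff_forall.mpr hall
        have h2 := Finset.card_insert_le a (insert x A ∪ insert y B)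
        have h3 := Finset.card_union_le (insert x A) (insert y B)
        rw [h1, Finset.card_univ] at h2
        omega
      obtain ⟨new, hnew⟩ := this
      simp only [Finset.mem_insert, Finset.mem_union, not_or] at hnew
      refine ⟨new, by simp; tauto, by simp; tauto, by simp, ?_⟩
      rw [Finset.insert_comm x a]
      apply ih _ _ _ _ _ _ _ _ hy
      · simp; tauto
      · simp; tauto
      · tauto
      · simp at hb ⊢; tauto
      · omega
    · refine ⟨y, by simp; tauto, by simp; tauto, by simp, ?_⟩
      rw [Finset.insert_comm x a, Finset.insert_comm y e]
      apply ih _ _ _ _ _ _ _ _ hy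
      · simp; tauto
      · simp; tauto
      · tauto
      · simp at hb ⊢; tauto
      · omega

/-- The second player steals the first-player strategy. -/
theorem wins_steal [Fintype V] [DecidableEq V] (a b : V) (hba : b ≠ a)
    (P Q : Finset V → Finset V → Prop)
    (hPQ : ∀ A B e, (b ∈ A ∨ b ∈ insert e B) → ¬ P B A → Q (insert a A) (insert e B)) :
    ∀ (k : ℕ) (A B : Finset V), 
      A.card + B.card + 2 * k + 2 ≤ Fintype.card V →
      ¬ SecondWins {a} P k B A → ∃ x, x ∉ insert a A ∧ x ∉ B ∧
        SecondWins ∅ Q k (insert a A) (insert x B) := by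
  intro k
  induction k with
  | zero =>
    intro A B hcard h
    by_cases hb : b ∈ A ∨ b ∈ B
    · have : ∃ new, new ∉ insert a (A ∪ B) := by
        by_contra hall
        push Not at hall
        have h1 := Finset.eq_univ_iff_forall.mpr hall
        have h2 := Finset.card_insert_le a (A ∪ B)
        have h3 := Finset.card_union_le A B
        rw [h1, Finset.card_univ] at h2
        omega
      obtain ⟨new, hnew⟩ := this
      simp only [Finset.mem_insert, Finset.mem_union, not_or] at hnew
      refine ⟨new, by simp; tauto, by tauto, hPQ A B new (by simp; tauto) h⟩
    · exact ⟨b, by simp; tauto, by tauto, hPQ A B b (by simp) h⟩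
  | succ k ih =>
    intro A B hcard h
    rw [SecondWins] at h
    push Not at h
    obtain ⟨x, hxB, hxA, hxa, h⟩ := h
    simp only [Finset.mem_singleton] at hxa
    refine ⟨x, by simp; tauto, hxB, ?_⟩
    intro y hyA hyB _
    simp only [Finset.mem_insert, not_or] at hyA hyB
    have hcA := Finset.card_insert_le y A
    have hcB := Finset.card_insert_le x B
    obtain ⟨z, hz1, hz2, hz⟩ := ih (insert y A) (insert x B) (by omega)
      (h y (by simp; tauto) hyA.2 (by simpa using hyA.1))
    rw [Finset.insert_comm a y] at hz1 hz
    exact ⟨z, hz1, hz2, by simp, hz⟩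

/-- Some neighbour of `a` is closer to a `1/Δ` fraction of the other vertices. -/
theorem exists_good_neighbor [Fintype V] [DecidableEq V] (G : SimpleGraph V) (hconn : G.Connected)
    (Δ : ℕ) (hdeg : ∀ v : V, (G.neighborSet v).ncard ≤ Δ) (hn : 2 ≤ Fintype.card V) (a : V) :
    ∃ b, b ≠ a ∧ ∃ S : Finset V, (∀ v ∈ S, G.dist b v < G.dist a v) ∧
      Fintype.card V ≤ Δ * S.card + 1 := by
  classical
  let N := G.neighborFinset a
  let T : V → Finset V := fun u => Finset.univ.filter fun v => G.dist u v < G.dist a v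
  have hcov : Finset.univ.erase a ⊆ N.biUnion T := by
    intro v hv
    have hva : a ≠ v := (Finset.ne_of_mem_erase hv).symm
    obtain ⟨p, hp⟩ := hconn.exists_walk_length_eq_dist a v
    cases p with
    | nil => exact absurd rfl hva
    | cons h q =>
      rename_i u
      simp only [Finset.mem_biUnion, N, T, mem_neighborFinset, Finset.mem_filter]
      refine ⟨u, h, Finset.mem_univ _, ?_⟩
      have := dist_le q
      simp only [Walk.length_cons] at hp
      omega
  have hNe : N.Nonempty := by
    by_contra h
    rw [Finset.not_nonempty_iff_eq_empty] at h
    have := Finset.card_le_card hcov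
    rw [h, Finset.card_erase_of_mem (Finset.mem_univ _), Finset.card_univ] at this
    simp at this
    omega
  obtain ⟨b, hb, hmax⟩ := Finset.exists_max_image N (fun u => (T u).card) hNe
  refine ⟨b, ?_, T b, ?_, ?_⟩
  · rw [mem_neighborFinset] at hb
    exact hb.ne'
  · intro v hv
    exact (Finset.mem_filter.mp hv).2
  · have h1 := Finset.card_le_card hcov
    have h2 := Finset.card_biUnion_le_card_mul N T (T b).card hmax
    have h3 : N.card ≤ Δ := by
      have := hdeg a
      rwa [← G.coe_neighborFinset, Set.ncard_coe_finset] at this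
    have h4 := Nat.mul_le_mul_right (T b).card h3
    rw [Finset.card_erase_of_mem (Finset.mem_univ _), Finset.card_univ] at h1
    omega

/-- A finite connected graph `G` with `n` vertices and maximum degree
`Δ ≥ 1` satisfies `VR(G, t) ≤ 1 − 1/(2Δ) + 1/(2nΔ)` for every `t ≥ 1` with `2t ≤ n`. -/
theorem vr_max_degree_many_rounds {V : Type*} [Fintype V] [DecidableEq V]
    (G : SimpleGraph V) (hconn : G.Connected) (n Δ : ℕ)
    (hn : n = Fintype.card V) (hΔ : 1 ≤ Δ)
    (hdeg : ∀ v : V, (G.neighborSet v).ncard ≤ Δ)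
    (hmax : ∃ v : V, (G.neighborSet v).ncard = Δ)
    (t : ℕ) (ht : 1 ≤ t) (h2t : 2 * t ≤ n) :
    VR G t ≤ 1 - 1 / (2 * (Δ : ℝ)) + 1 / (2 * (n : ℝ) * Δ) := by
  obtain ⟨t, rfl⟩ : ∃ k, t = k + 1 := ⟨t - 1, by omega⟩
  subst hn
  set n := Fintype.card V with hn
  have hnR : (0 : ℝ) < n := by
    have : 0 < n := by omega
    exact_mod_cast this
  have hn1 : (1 : ℝ) ≤ n := by
    have : 1 ≤ n := by omega
    exact_mod_cast this
  have hΔ1 : (1 : ℝ) ≤ Δ := by exact_mod_cast hΔ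
  have hΔR : (0 : ℝ) < Δ := by linarith
  set c : ℝ := n - ((n : ℝ) - 1) / (2 * Δ) with hcdef
  have hc : 0 ≤ c := by
    have : ((n : ℝ) - 1) / (2 * Δ) ≤ n := by
      rw [div_le_iff₀ (by linarith)]
      nlinarith
    linarith
  have key : gameValue G (t + 1) ∅ ∅ ≤ c := by
    apply gameValue_le_of_wins G c hc
    intro a _ _ _
    obtain ⟨b, hba, S, hS, hcard⟩ := exists_good_neighbor G hconn Δ hdeg (by omega) a
    have hSc : (n : ℝ) - (S.card : ℝ) / 2 ≤ c := by
      have h1 : (n : ℝ) ≤ Δ * S.card + 1 := by exact_mod_cast hcard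
      have h2 : ((n : ℝ) - 1) / (2 * Δ) ≤ (S.card : ℝ) / 2 := by
        rw [div_le_div_iff₀ (by linarith) (by norm_num)]
        linarith
      linarith
    let P : Finset V → Finset V → Prop := fun A B =>
      (S.card : ℝ) ≤ 2 * ∑ v ∈ S, ptB G A B v
    let Q : Finset V → Finset V → Prop := fun A B => scoreA G A B ≤ c
    have hmono : ∀ A B e, ∑ v ∈ S, ptB G A B v ≤ ∑ v ∈ S, ptB G A (insert e B) v :=
      fun A B e => Finset.sum_le_sum fun v _ => ptB_mono G A B e v
    have hPQ1 : ∀ A B e, (b ∈ A ∨ b ∈ insert e B) → P A B → Q (insert a A) (insert e B) := by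
      intro A B e hb hP
      refine (scoreA_le_of G a b S A (insert e B) hS hb ?_).trans hSc
      have := hmono A B e
      have hPP : (S.card : ℝ) ≤ 2 * ∑ v ∈ S, ptB G A B v := hP
      linarith
    have hPQ2 : ∀ A B e, (b ∈ A ∨ b ∈ insert e B) → ¬ P B A → Q (insert a A) (insert e B) := by
      intro A B e hb hP
      apply hPQ1 A B e hb
      have hPP : 2 * ∑ v ∈ S, ptB G B A v < (S.card : ℝ) := not_le.mp hP
      have hsum : ∑ v ∈ S, ptB G A B v + ∑ v ∈ S, ptB G B A v = S.card := by
        rw [← Finset.sum_add_distrib]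
        simp [ptB_swap]
      change (S.card : ℝ) ≤ 2 * ∑ v ∈ S, ptB G A B v
      linarith
    by_cases hw : SecondWins {a} P t ∅ ∅
    · refine ⟨b, by simpa using hba, by simp, by simp, ?_⟩
      exact wins_extra a b P Q hPQ1 t ∅ ∅ b (by simp) (by simp) hba (by simp)
        (by simp only [Finset.card_empty]; omega) hw
    · obtain ⟨x, hx1, hx2, hx⟩ := wins_steal a b hba P Q hPQ2 t ∅ ∅
        (by simp only [Finset.card_empty]; omega) hw
      exact ⟨x, hx1, hx2, by simp, hx⟩
  unfold VR
  rw [← hn, div_le_iff₀ hnR]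
  refine key.trans (le_of_eq ?_)
  rw [hcdef]
  field_simp
  ring
end
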